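/- arXiv:math/0010170 — 3 statements merged into one kernel-verified Lean document; each statement's English description precedes it below -/
import Mathlib

section
/- For each j ∈ {1,2,3}, with δ = δ(j), and all real z > 0 (for j = 1 restricted to 0 < z < 2/(1-q²)), the modified q-Bessel functions satisfy the recurrence relations q^{-(2-δ)ν/2} I_{ν-1}^{(j)}((1-q²)z;q²) - q^{(2-δ)ν/2} I_{ν+1}^{(j)}((1-q²)z;q²) = (2/((1-q²)z)) (q^{-ν} - q^{ν}) I_ν^{(j)}((1-q²) q^{δ/2} z;q²) and q^{-(2-δ)ν/2} I_{ν-1}^{(j)}((1-q²)z;q²) + q^{(2-δ)ν/2} I_{ν+1}^{(j)}((1-q²)z;q²) = (4/((1-q²)z)) I_ν^{(j)}((1-q²) q^{-(2-δ)/2} z;q²) - (2/((1-q²)z)) (q^{-ν} + q^{ν}) I_ν^{(j)}((1-q²) q^{δ/2} z;q²). -/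
open Real Filter

noncomputable section

/-- Finite q-Pochhammer symbol `(a;q)_n = ∏_{j=0}^{n-1} (1 - a q^j)`. -/
def qPoch (a q : ℝ) (n : ℕ) : ℝ := ∏ j ∈ Finset.range n, (1 - a * q ^ j)

/-- Infinite q-Pochhammer symbol `(a;q)_∞ = ∏_{j=0}^{∞} (1 - a q^j)`. -/
def qPochInf (a q : ℝ) : ℝ := ∏' j : ℕ, (1 - a * q ^ j)

/-- The q²-Gamma function `Γ_{q²}(x) = (q²;q²)_∞ (1-q²)^{1-x} / (q^{2x};q²)_∞`. -/
def qGamma (q x : ℝ) : ℝ :=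
  qPochInf (q ^ 2) (q ^ 2) * (1 - q ^ 2) ^ (1 - x) / qPochInf (q ^ (2 * x)) (q ^ 2)

/-- The reciprocal `1/Γ_{q²}(x)`, interpreted as `(q^{2x};q²)_∞ (1-q²)^{x-1} / (q²;q²)_∞`
(vanishing at nonpositive integers `x`). -/
def qGammaInv (q x : ℝ) : ℝ :=
  qPochInf (q ^ (2 * x)) (q ^ 2) * (1 - q ^ 2) ^ (x - 1) / qPochInf (q ^ 2) (q ^ 2)

/-- `δ(1) = 2`, `δ(2) = 0`, `δ(3) = 1`. -/
def delta : ℕ → ℝ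
  | 1 => 2
  | 2 => 0
  | 3 => 1
  | _ => 0

/-- The modified q-Bessel function of kind `j`: `Iq q j ν z = I_ν^{(j)}((1-q²)z; q²)`.
The extra power of `q` in the `k`-th term is `q^{(2-δ(j)) k (ν+k)}`, i.e. `1` for `j = 1`,
`q^{2k(ν+k)}` for `j = 2`, and `q^{k(ν+k)}` for `j = 3`. -/
def Iq (q : ℝ) (j : ℕ) (ν z : ℝ) : ℝ :=
  ∑' k : ℕ,
    q ^ ((2 - delta j) * k * (ν + k)) * (1 - q ^ 2) ^ k * (z / 2) ^ (ν + 2 * k)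
      / qPoch (q ^ 2) (q ^ 2) k * qGammaInv q (ν + k + 1)



/-- general term with `c = 2 - δ`. -/
def bT (q c ν z : ℝ) (k : ℕ) : ℝ :=
    q ^ (c * k * (ν + k)) * (1 - q ^ 2) ^ k * (z / 2) ^ (ν + 2 * k)
      / qPoch (q ^ 2) (q ^ 2) k * qGammaInv q (ν + k + 1)

lemma qPochInf_step (a p : ℝ) (h0 : 0 < p) (h1 : p < 1) :
    qPochInf a p = (1 - a) * qPochInf (a * p) p := by
  have hs : Summable (fun j : ℕ => ‖-(a * p * p ^ j)‖) :=
    ((summable_geometric_of_lt_one h0.le h1).mul_left (a * p)).neg.norm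
  have hm := multipliable_one_add_of_summable hs
  have he : (fun j : ℕ => 1 + -(a * p * p ^ j)) = fun j : ℕ => 1 - a * p ^ (j + 1) := by
    funext j
    rw [pow_succ]; ring
  have he2 : (fun j : ℕ => 1 - a * p * p ^ j) = fun j : ℕ => 1 - a * p ^ (j + 1) := by
    funext j
    rw [pow_succ]; ring
  rw [he] at hm
  have hf := tprod_eq_zero_mul' (f := fun j : ℕ => 1 - a * p ^ j) hm
  unfold qPochInf
  rw [he2, hf, pow_zero, mul_one]

lemma qGammaInv_step (q x : ℝ) (h0 : 0 < q) (h1 : q < 1) :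
    qGammaInv q x = (1 - q ^ (2 * x)) / (1 - q ^ 2) * qGammaInv q (x + 1) := by
  have hp0 : 0 < q ^ 2 := by positivity
  have hp1 : q ^ 2 < 1 := by nlinarith
  unfold qGammaInv
  rw [qPochInf_step _ _ hp0 hp1]
  have e1 : q ^ (2 * (x + 1)) = q ^ (2 * x) * q ^ 2 := by
    rw [mul_add, Real.rpow_add h0]; norm_num
  have e2 : (1 - q ^ 2) ^ (x + 1 - 1) = (1 - q ^ 2) ^ (x - 1) * (1 - q ^ 2) := by
    rw [← Real.rpow_add_one (by linarith)]; congr 1; ring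
  rw [e1, e2]
  have : (1 - q ^ 2) ≠ 0 := by linarith
  field_simp

lemma qPoch_succ (a q : ℝ) (n : ℕ) : qPoch a q (n + 1) = qPoch a q n * (1 - a * q ^ n) := by
  unfold qPoch; rw [Finset.prod_range_succ]

lemma pf_ne (q : ℝ) (h0 : 0 < q) (h1 : q < 1) (n : ℕ) : 1 - q ^ 2 * (q ^ 2) ^ n ≠ 0 := by
  have : q ^ 2 * (q ^ 2) ^ n < 1 := by
    rw [← pow_succ', ← pow_mul]; exact pow_lt_one₀ h0.le h1 (by omega)
  linarith

lemma qPoch_ne (q : ℝ) (h0 : 0 < q) (h1 : q < 1) (n : ℕ) : qPoch (q ^ 2) (q ^ 2) n ≠ 0 := by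
  unfold qPoch
  exact Finset.prod_ne_zero_iff.2 fun i _ => pf_ne q h0 h1 i

lemma bT_minus (q c ν z : ℝ) (h0 : 0 < q) (h1 : q < 1) (hz : 0 < z) (k : ℕ) :
    bT q c (ν - 1) z k = q ^ (-(c * k)) * (2 / z) * ((1 - q ^ (2 * (ν + k))) / (1 - q ^ 2))
      * bT q c ν z k := by
  unfold bT
  have e0 : ν - 1 + k + 1 = ν + k := by ring
  have e1 : q ^ (c * k * (ν - 1 + k)) = q ^ (-(c * k)) * q ^ (c * k * (ν + k)) := by
    rw [← Real.rpow_add h0]; congr 1; ring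
  have e2 : (z / 2) ^ (ν - 1 + 2 * k) = (z / 2) ^ (ν + 2 * k) * (2 / z) := by
    have : ν - 1 + 2 * k = ν + 2 * k - 1 := by ring
    rw [this, Real.rpow_sub_one (by positivity)]
    field_simp
  rw [e0, e1, e2, qGammaInv_step q (ν + k) h0 h1]
  ring

lemma bT_plus (q c ν z : ℝ) (h0 : 0 < q) (h1 : q < 1) (hz : 0 < z) (k : ℕ) :
    bT q c (ν + 1) z k = q ^ (-(c * (ν + (k + 1 : ℕ)))) * (2 / z)
      * ((1 - (q ^ 2) ^ (k + 1)) / (1 - q ^ 2)) * bT q c ν z (k + 1) := by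
  unfold bT
  have hp1 : q ^ 2 < 1 := by nlinarith
  have hne : (1 - q ^ 2) ≠ 0 := by linarith
  have e0 : ν + 1 + k + 1 = ν + (k + 1 : ℕ) + 1 := by push_cast; ring
  have e1 : q ^ (c * k * (ν + 1 + k)) = q ^ (-(c * (ν + (k + 1 : ℕ))))
      * q ^ (c * (k + 1 : ℕ) * (ν + (k + 1 : ℕ))) := by
    rw [← Real.rpow_add h0]; congr 1; push_cast; ring
  have e2 : (z / 2) ^ (ν + 1 + 2 * k) = (z / 2) ^ (ν + 2 * (k + 1 : ℕ)) * (2 / z) := by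
    have : ν + 1 + 2 * k = ν + 2 * (k + 1 : ℕ) - 1 := by push_cast; ring
    rw [this, Real.rpow_sub_one (by positivity)]
    field_simp
  have h2 := qPoch_ne q h0 h1 k
  have h3 := pf_ne q h0 h1 k
  rw [e0, e1, e2, qPoch_succ, pow_succ (1 - q ^ 2) k, pow_succ' (q ^ 2) k]
  field_simp

lemma bT_scale (q c ν z s : ℝ) (h0 : 0 < q) (hz : 0 < z) (k : ℕ) :
    bT q c ν (q ^ s * z) k = q ^ (s * (ν + 2 * k)) * bT q c ν z k := by
  unfold bT
  rw [mul_div_assoc (q ^ s) z 2, Real.mul_rpow (by positivity) (by positivity), ← Real.rpow_mul h0.le]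
  ring

lemma bT_ratio (q c ν z : ℝ) (h0 : 0 < q) (h1 : q < 1) (hz : 0 < z) (k : ℕ)
    (hk : 0 < ν + k + 1) :
    bT q c ν z (k + 1) = (q ^ (c * (ν + 2 * k + 1)) * ((1 - q ^ 2) * (z / 2)) ^ 2
      / (1 - q ^ 2 * (q ^ 2) ^ k) / (1 - q ^ (2 * (ν + k + 1)))) * bT q c ν z k := by
  unfold bT
  have hp1 : q ^ 2 < 1 := by nlinarith
  have hne : (1 - q ^ 2) ≠ 0 := by linarith
  have e0 : ν + (k + 1 : ℕ) + 1 = ν + k + 1 + 1 := by push_cast; ring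
  have e1 : q ^ (c * (k + 1 : ℕ) * (ν + (k + 1 : ℕ))) = q ^ (c * (ν + 2 * k + 1))
      * q ^ (c * k * (ν + k)) := by
    rw [← Real.rpow_add h0]; congr 1; push_cast; ring
  have e2 : (z / 2) ^ (ν + 2 * (k + 1 : ℕ)) = (z / 2) ^ (ν + 2 * k) * (z / 2) ^ 2 := by
    rw [← Real.rpow_add_natCast (by positivity)]; congr 1; push_cast; ring
  have h2 := qPoch_ne q h0 h1 k
  have h3 := pf_ne q h0 h1 k
  have h4 : 1 - q ^ (2 * (ν + k + 1)) ≠ 0 := by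
    have := Real.rpow_lt_one h0.le h1 (show 0 < 2 * (ν + k + 1) by linarith)
    linarith
  rw [e0, e1, e2, qPoch_succ, pow_succ (1 - q ^ 2) k, qGammaInv_step q (ν + k + 1) h0 h1]
  field_simp

lemma tendsto_rpow_lin (q a b : ℝ) (h0 : 0 < q) (h1 : q < 1) (ha : 0 < a) :
    Tendsto (fun k : ℕ => q ^ (a * k + b)) atTop (nhds 0) := by
  have h := tendsto_rpow_atTop_of_base_lt_one q (by linarith) h1
  refine h.comp ?_
  exact tendsto_atTop_add_const_right _ _
    (tendsto_natCast_atTop_atTop.const_mul_atTop ha)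

lemma bT_summable (q c ν z : ℝ) (h0 : 0 < q) (h1 : q < 1) (hc : 0 ≤ c) (hz : 0 < z)
    (hz1 : c = 0 → z < 2 / (1 - q ^ 2)) : Summable (bT q c ν z) := by
  have hp1 : q ^ 2 < 1 := by nlinarith
  have hp0 : 0 < q ^ 2 := by positivity
  set ρ : ℕ → ℝ := fun k => q ^ (c * (ν + 2 * k + 1)) * ((1 - q ^ 2) * (z / 2)) ^ 2
      / (1 - q ^ 2 * (q ^ 2) ^ k) / (1 - q ^ (2 * (ν + k + 1))) with hρ
  have t2 : Tendsto (fun k : ℕ => 1 - q ^ 2 * (q ^ 2) ^ k) atTop (nhds 1) := by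
    have := ((tendsto_pow_atTop_nhds_zero_of_lt_one hp0.le hp1).const_mul (q ^ 2)).const_sub 1
    simpa using this
  have t3 : Tendsto (fun k : ℕ => 1 - q ^ (2 * (ν + k + 1))) atTop (nhds 1) := by
    have := (tendsto_rpow_lin q 2 (2 * (ν + 1)) h0 h1 (by norm_num)).const_sub 1
    rw [sub_zero] at this
    refine this.congr fun k => ?_
    congr 2; ring
  obtain ⟨L, hL, hT⟩ : ∃ L : ℝ, L < 1 ∧ Tendsto ρ atTop (nhds L) := by
    rcases hc.eq_or_lt with h | h
    · refine ⟨((1 - q ^ 2) * (z / 2)) ^ 2, ?_, ?_⟩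
      · have := hz1 h.symm
        rw [lt_div_iff₀ (by linarith)] at this
        have h5 : (1 - q ^ 2) * (z / 2) < 1 := by linarith
        have h6 : 0 ≤ (1 - q ^ 2) * (z / 2) := mul_nonneg (by linarith) (by positivity)
        exact pow_lt_one₀ h6 h5 (by norm_num)
      · have t1 : Tendsto (fun k : ℕ => q ^ (c * (ν + 2 * k + 1)) * ((1 - q ^ 2) * (z / 2)) ^ 2)
            atTop (nhds (((1 - q ^ 2) * (z / 2)) ^ 2)) := by
          simp [← h]
        have t4 := (t1.div t2 one_ne_zero).div t3 one_ne_zero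
        rw [div_one, div_one] at t4
        exact t4
    · refine ⟨0, one_pos, ?_⟩
      have t1 : Tendsto (fun k : ℕ => q ^ (c * (ν + 2 * k + 1)) * ((1 - q ^ 2) * (z / 2)) ^ 2)
            atTop (nhds 0) := by
        have := (tendsto_rpow_lin q (2 * c) (c * (ν + 1)) h0 h1 (by linarith)).mul_const
          (((1 - q ^ 2) * (z / 2)) ^ 2)
        rw [zero_mul] at this
        refine this.congr fun k => ?_
        congr 2; ring
      have t4 := (t1.div t2 one_ne_zero).div t3 one_ne_zero
      rw [div_one, div_one] at t4
      exact t4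
  have hLabs : |L| < 1 := by
    have : 0 ≤ L := by
      refine ge_of_tendsto hT ?_
      filter_upwards [t2.eventually_const_lt (u := 0) one_pos,
        t3.eventually_const_lt (u := 0) one_pos] with k hk1 hk2
      simp only [hρ]
      positivity
    rwa [abs_of_nonneg this]
  obtain ⟨r, hr1, hr2⟩ := exists_between hLabs
  refine summable_of_ratio_norm_eventually_le hr2 ?_
  have hev : ∀ᶠ k : ℕ in atTop, 0 < ν + k + 1 := by
    filter_upwards [tendsto_natCast_atTop_atTop.eventually_gt_atTop (-ν)] with k hk
    linarith
  filter_upwards [hev, hT.abs.eventually_lt_const hr1] with k hk1 hk2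
  rw [bT_ratio q c ν z h0 h1 hz k hk1, norm_mul]
  exact mul_le_mul_of_nonneg_right hk2.le (norm_nonneg _)

lemma bT_main (q c ν z : ℝ) (h0 : 0 < q) (h1 : q < 1) (hc : 0 ≤ c) (hz : 0 < z)
    (hz1 : c = 0 → z < 2 / (1 - q ^ 2)) :
    q ^ (-(c * ν / 2)) * (∑' k, bT q c (ν - 1) z k)
        - q ^ (c * ν / 2) * (∑' k, bT q c (ν + 1) z k)
      = 2 / ((1 - q ^ 2) * z) * (q ^ (-ν) - q ^ ν) * (∑' k, bT q c ν (q ^ ((2 - c) / 2) * z) k)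
  ∧ q ^ (-(c * ν / 2)) * (∑' k, bT q c (ν - 1) z k)
        + q ^ (c * ν / 2) * (∑' k, bT q c (ν + 1) z k)
      = 4 / ((1 - q ^ 2) * z) * (∑' k, bT q c ν (q ^ (-(c / 2)) * z) k)
        - 2 / ((1 - q ^ 2) * z) * (q ^ (-ν) + q ^ ν)
          * (∑' k, bT q c ν (q ^ ((2 - c) / 2) * z) k) := by
  have hp1 : q ^ 2 < 1 := by nlinarith
  have hne : (1 - q ^ 2) ≠ 0 := by linarith
  have H1 := (bT_summable q c (ν - 1) z h0 h1 hc hz hz1).hasSum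
  have H2 := (bT_summable q c (ν + 1) z h0 h1 hc hz hz1).hasSum
  have H3 := (bT_summable q c ν (q ^ ((2 - c) / 2) * z) h0 h1 hc (by positivity) (by
    intro h
    have := hz1 h
    subst h
    norm_num
    nlinarith)).hasSum
  have H4 := (bT_summable q c ν (q ^ (-(c / 2)) * z) h0 h1 hc (by positivity) (by
    intro h
    have := hz1 h
    subst h
    simpa using this)).hasSum
  set b : ℕ → ℝ := fun k => q ^ (-(c * (ν + k))) * (2 / z)
      * ((1 - (q ^ 2) ^ k) / (1 - q ^ 2)) * bT q c ν z k with hb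
  have H2' : HasSum b (∑' k, bT q c (ν + 1) z k) := by
    have e : bT q c (ν + 1) z = fun k => b (k + 1) := by
      funext k; exact bT_plus q c ν z h0 h1 hz k
    have hb0 : b 0 = 0 := by simp [hb]
    rw [e] at H2 ⊢
    have := (hasSum_nat_add_iff (f := b) 1).1 H2
    simpa [hb0] using this
  have key1 : ∀ k : ℕ, q ^ (-(c * ν / 2)) * bT q c (ν - 1) z k
      = 2 / ((1 - q ^ 2) * z) * (bT q c ν (q ^ (-(c / 2)) * z) k
        - q ^ ν * bT q c ν (q ^ ((2 - c) / 2) * z) k) := by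
    intro k
    rw [bT_minus q c ν z h0 h1 hz, bT_scale _ _ _ _ _ h0 hz, bT_scale _ _ _ _ _ h0 hz]
    have e1 : q ^ (-(c / 2) * (ν + 2 * k)) = q ^ (-(c * ν / 2)) * q ^ (-(c * k)) := by
      rw [← Real.rpow_add h0]; congr 1; ring
    have e2 : q ^ ν * q ^ ((2 - c) / 2 * (ν + 2 * k))
        = q ^ (-(c * ν / 2)) * q ^ (-(c * k)) * q ^ (2 * (ν + k)) := by
      rw [← Real.rpow_add h0, ← Real.rpow_add h0, ← Real.rpow_add h0]; congr 1; ring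
    rw [← mul_assoc (q ^ ν), e1, e2]
    field_simp
  have key2 : ∀ k : ℕ, q ^ (c * ν / 2) * b k
      = 2 / ((1 - q ^ 2) * z) * (bT q c ν (q ^ (-(c / 2)) * z) k
        - q ^ (-ν) * bT q c ν (q ^ ((2 - c) / 2) * z) k) := by
    intro k
    rw [bT_scale _ _ _ _ _ h0 hz, bT_scale _ _ _ _ _ h0 hz]
    simp only [hb]
    have e0 : (q ^ 2) ^ k = q ^ (2 * k : ℝ) := by
      rw [← pow_mul, ← Real.rpow_natCast]; push_cast; rfl
    have e1 : q ^ (-(c / 2) * (ν + 2 * k)) = q ^ (c * ν / 2) * q ^ (-(c * (ν + k))) := by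
      rw [← Real.rpow_add h0]; congr 1; ring
    have e2 : q ^ (-ν) * q ^ ((2 - c) / 2 * (ν + 2 * k))
        = q ^ (c * ν / 2) * q ^ (-(c * (ν + k))) * q ^ (2 * k : ℝ) := by
      rw [← Real.rpow_add h0, ← Real.rpow_add h0, ← Real.rpow_add h0]; congr 1; ring
    rw [← mul_assoc (q ^ (-ν)), e0, e1, e2]
    field_simp
  have K1 := (H1.mul_left (q ^ (-(c * ν / 2)))).unique
    (((H4.sub (H3.mul_left (q ^ ν))).mul_left (2 / ((1 - q ^ 2) * z))).congr_fun key1)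
  have K2 := (H2'.mul_left (q ^ (c * ν / 2))).unique
    (((H4.sub (H3.mul_left (q ^ (-ν)))).mul_left (2 / ((1 - q ^ 2) * z))).congr_fun key2)
  rw [K1, K2]
  constructor <;> ring

/-- recurrence relations for the modified q-Bessel functions. -/
theorem stmt2 (q ν : ℝ) (hq0 : 0 < q) (hq1 : q < 1)
    (j : ℕ) (hj : j = 1 ∨ j = 2 ∨ j = 3)
    (z : ℝ) (hz : 0 < z) (hz1 : j = 1 → z < 2 / (1 - q ^ 2)) :
    q ^ (-((2 - delta j) * ν / 2)) * Iq q j (ν - 1) z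
        - q ^ ((2 - delta j) * ν / 2) * Iq q j (ν + 1) z
      = 2 / ((1 - q ^ 2) * z) * (q ^ (-ν) - q ^ ν) * Iq q j ν (q ^ (delta j / 2) * z)
  ∧ q ^ (-((2 - delta j) * ν / 2)) * Iq q j (ν - 1) z
        + q ^ ((2 - delta j) * ν / 2) * Iq q j (ν + 1) z
      = 4 / ((1 - q ^ 2) * z) * Iq q j ν (q ^ (-((2 - delta j) / 2)) * z)
        - 2 / ((1 - q ^ 2) * z) * (q ^ (-ν) + q ^ ν) * Iq q j ν (q ^ (delta j / 2) * z) := by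
  have hc : 0 ≤ 2 - delta j := by
    rcases hj with rfl | rfl | rfl <;> norm_num [delta]
  have hc0 : 2 - delta j = 0 → z < 2 / (1 - q ^ 2) := by
    rcases hj with rfl | rfl | rfl <;> norm_num [delta]
    simpa using hz1
  have h := bT_main q (2 - delta j) ν z hq0 hq1 hc hz hc0
  have e : (2 - (2 - delta j)) / 2 = delta j / 2 := by ring
  rw [e] at h
  exact h

end
end

section
/- For each j ∈ {1,2,3}, with δ = δ(j), and all real z > 0 (for j = 1 restricted to 0 < z < 2/(1-q²)), the q-Wronskian of I_ν^{(j)} and I_{-ν}^{(j)} equals W(I_ν^{(j)}, I_{-ν}^{(j)})(z) = [q^{-ν}(1-q²)/(Γ_{q²}(ν) Γ_{q²}(1-ν))] · e_{q²}((1-q²)² z²/4) if δ = 2; = q^{-ν}(1-q²)/(Γ_{q²}(ν) Γ_{q²}(1-ν)) if δ = 1; = [q^{-ν}(1-q²)/(Γ_{q²}(ν) Γ_{q²}(1-ν))] · E_{q²}(-(1-q²)² q² z²/4) if δ = 0, where W is taken of the functions z ↦ I_{±ν}^{(j)}((1-q²)z;q²). -/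
open Real Filter

noncomputable section

/-- q-Wronskian `W(f,g)(z) = f(z) g(qz) - f(qz) g(z)`. -/
def qWron (q : ℝ) (f g : ℝ → ℝ) (z : ℝ) : ℝ := f z * g (q * z) - f (q * z) * g z


open Topology

lemma aux_multipliable (a p : ℝ) (hp0 : 0 < p) (hp1 : p < 1) :
    Multipliable (fun j : ℕ => 1 - a * p ^ j) := by
  have : Summable (fun j : ℕ => ‖-(a * p ^ j)‖) := by
    have h := ((summable_geometric_of_lt_one hp0.le hp1).mul_left a).norm
    simpa using h
  have h := multipliable_one_add_of_summable this
  simpa [sub_eq_add_neg] using h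

lemma aux_qPochInf_step (a p : ℝ) (hp0 : 0 < p) (hp1 : p < 1) :
    qPochInf a p = (1 - a) * qPochInf (a * p) p := by
  unfold qPochInf
  have e : (fun j : ℕ => 1 - a * p * p ^ j) = fun j : ℕ => 1 - a * p ^ (j + 1) := by
    funext j; ring
  rw [e, tprod_eq_zero_mul' (f := fun j : ℕ => 1 - a * p ^ j)]
  · simp
  · have := aux_multipliable (a * p) p hp0 hp1
    rw [e] at this
    exact this

lemma aux_qPoch_tendsto (a p : ℝ) (hp0 : 0 < p) (hp1 : p < 1) :
    Tendsto (fun n => qPoch a p n) atTop (𝓝 (qPochInf a p)) :=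
  (aux_multipliable a p hp0 hp1).hasProd.tendsto_prod_nat

lemma aux_qPochInf_ne (a p : ℝ) (ha0 : 0 ≤ a) (ha : a < 1) (hp0 : 0 < p) (hp1 : p < 1) :
    qPochInf a p ≠ 0 := by
  have hs : Summable (fun j : ℕ => ‖-(a * p ^ j)‖) := by
    have h := ((summable_geometric_of_lt_one hp0.le hp1).mul_left a).norm
    simpa using h
  have h := tprod_one_add_ne_zero_of_summable (f := fun j : ℕ => -(a * p ^ j)) (by
    intro i
    have : p ^ i ≤ 1 := pow_le_one₀ hp0.le hp1.le
    have h0 : 0 < p ^ i := pow_pos hp0 i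
    have : a * p ^ i < 1 := by nlinarith
    linarith) hs
  simpa [qPochInf, sub_eq_add_neg] using h

lemma aux_gamma (q x : ℝ) (hq0 : 0 < q) (hq1 : q < 1) :
    qGammaInv q x * (1 - q ^ 2) = (1 - q ^ (2 * x)) * qGammaInv q (x + 1) := by
  have hp1 : q ^ 2 < 1 := by nlinarith
  have hp0 : 0 < q ^ 2 := by positivity
  unfold qGammaInv
  rw [aux_qPochInf_step (q ^ (2 * x)) _ hp0 hp1]
  have e : q ^ (2 * (x + 1)) = q ^ (2 * x) * q ^ 2 := by
    rw [mul_add, rpow_add hq0]; norm_num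
  have e2 : (1 - q ^ 2) ^ (x + 1 - 1) = (1 - q ^ 2) ^ (x - 1) * (1 - q ^ 2) := by
    rw [show x + 1 - 1 = (x - 1) + 1 by ring, rpow_add (by linarith), rpow_one]
  rw [e, e2]
  ring

def auxCf (q s ν : ℝ) (k : ℕ) : ℝ :=
  q ^ (s * k * (ν + k)) * (1 - q ^ 2) ^ k / qPoch (q ^ 2) (q ^ 2) k * qGammaInv q (ν + k + 1)

lemma aux_qPoch_ne (p : ℝ) (hp0 : 0 < p) (hp1 : p < 1) (k : ℕ) : qPoch p p k ≠ 0 := by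
  unfold qPoch
  refine Finset.prod_ne_zero_iff.mpr fun j _ => ?_
  have : p ^ j ≤ 1 := pow_le_one₀ hp0.le hp1.le
  nlinarith

lemma auxCf_zero (q s ν : ℝ) : auxCf q s ν 0 = qGammaInv q (ν + 1) := by
  simp [auxCf, qPoch]

lemma auxCf_succ (q s ν : ℝ) (hq0 : 0 < q) (hq1 : q < 1) (k : ℕ) :
    auxCf q s ν (k + 1) * ((1 - (q ^ 2) ^ (k + 1)) * (1 - q ^ (2 * ν) * (q ^ 2) ^ (k + 1)))
      = auxCf q s ν k * (q ^ (s * (ν + 1)) * (q ^ (2 * s)) ^ k * (1 - q ^ 2) ^ 2) := by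
  have hp1 : q ^ 2 < 1 := by nlinarith
  have hp0 : 0 < q ^ 2 := by positivity
  have h1 := aux_qPoch_ne _ hp0 hp1 k
  have h2 : (1 - (q ^ 2) ^ (k + 1)) ≠ 0 := by
    have : (q ^ 2) ^ (k + 1) < 1 := pow_lt_one₀ hp0.le hp1 (by simp)
    linarith
  have h3 : qPoch (q ^ 2) (q ^ 2) (k + 1) = qPoch (q ^ 2) (q ^ 2) k * (1 - (q ^ 2) ^ (k + 1)) := by
    unfold qPoch
    rw [Finset.prod_range_succ, pow_succ' (q ^ 2) k]
  have hg := aux_gamma q (ν + k + 1) hq0 hq1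
  have e1 : q ^ (2 * (ν + k + 1)) = q ^ (2 * ν) * (q ^ 2) ^ (k + 1) := by
    rw [show 2 * (ν + k + 1) = 2 * ν + ((2 * (k + 1) : ℕ) : ℝ) by push_cast; ring,
      rpow_add hq0, rpow_natCast, pow_mul]
  have e2 : q ^ (s * ((k + 1 : ℕ) : ℝ) * (ν + ((k + 1 : ℕ) : ℝ)))
      = q ^ (s * k * (ν + k)) * (q ^ (s * (ν + 1)) * (q ^ (2 * s)) ^ k) := by
    rw [← rpow_natCast (q ^ (2 * s)) k, ← rpow_mul hq0.le, ← rpow_add hq0, ← rpow_add hq0]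
    congr 1
    push_cast; ring
  have e3 : ν + ((k + 1 : ℕ) : ℝ) + 1 = ν + k + 1 + 1 := by push_cast; ring
  rw [e1] at hg
  unfold auxCf
  rw [e2, h3, e3, pow_succ (1 - q ^ 2) k]
  generalize q ^ (s * k * (ν + k)) = A at *
  generalize q ^ (s * (ν + 1)) * (q ^ (2 * s)) ^ k = B at *
  generalize q ^ (2 * ν) = T at *
  generalize (q ^ 2) ^ (k + 1) = P at *
  generalize (1 - q ^ 2) ^ k = R at *
  generalize 1 - q ^ 2 = S at *
  generalize qPoch (q ^ 2) (q ^ 2) k = Q at *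
  generalize qGammaInv q (ν + k + 1 + 1) = G at *
  generalize qGammaInv q (ν + k + 1) = H at *
  have e4 : A * B * (R * S) / (Q * (1 - P)) * G * ((1 - P) * (1 - T * P))
      = A * B * (R * S) / Q * ((1 - T * P) * G) := by
    field_simp
  rw [e4, ← hg]
  ring

lemma aux_summable (p t x L : ℝ) (a U : ℕ → ℝ) (hp0 : 0 < p) (hp1 : p < 1) (hx : 0 < x)
    (ha : ∀ k, a (k + 1) * ((1 - p ^ (k + 1)) * (1 - t * p ^ (k + 1))) = a k * U k)
    (hU : ∀ k, 0 ≤ U k) (hL : Tendsto (fun k => U k * x) atTop (𝓝 L)) (hL1 : L < 1) :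
    Summable (fun k => ‖a k * x ^ k‖) := by
  have hp : Tendsto (fun k : ℕ => p ^ (k + 1)) atTop (𝓝 0) :=
    (tendsto_add_atTop_iff_nat 1).2 (tendsto_pow_atTop_nhds_zero_of_lt_one hp0.le hp1)
  have hd : Tendsto (fun k : ℕ => (1 - p ^ (k + 1)) * (1 - t * p ^ (k + 1))) atTop (𝓝 1) := by
    have := (hp.const_sub 1).mul ((hp.const_mul t).const_sub 1)
    simpa using this
  have hr := hL.div hd one_ne_zero
  rw [div_one] at hr
  have hlt : L < (L + 1) / 2 := by linarith
  refine summable_of_ratio_norm_eventually_le (r := (L + 1) / 2) (by linarith) ?_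
  filter_upwards [hr.eventually_lt_const hlt, hd.eventually_const_lt (zero_lt_one)] with k h1 h2
  rw [norm_norm, norm_norm]
  have e : a (k + 1) * x ^ (k + 1)
      = (U k * x / ((1 - p ^ (k + 1)) * (1 - t * p ^ (k + 1)))) * (a k * x ^ k) := by
    rw [div_mul_eq_mul_div, eq_div_iff h2.ne']
    linear_combination x ^ (k + 1) * ha k
  rw [e, norm_mul]
  gcongr
  rw [Real.norm_eq_abs, abs_of_nonneg (div_nonneg (mul_nonneg (hU k) hx.le) h2.le)]
  exact h1.le

def auxF (a : ℕ → ℝ) (x : ℝ) : ℝ := ∑' k, a k * x ^ k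

lemma aux_summable_mul (a : ℕ → ℝ) (x c : ℝ) (hc0 : 0 ≤ c) (hc1 : c ≤ 1)
    (h : Summable (fun k => ‖a k * x ^ k‖)) : Summable (fun k => ‖a k * (c * x) ^ k‖) := by
  refine Summable.of_nonneg_of_le (fun _ => norm_nonneg _) (fun k => ?_) h
  rw [mul_pow, norm_mul, norm_mul, norm_mul]
  have : ‖c ^ k‖ ≤ 1 := by
    rw [Real.norm_eq_abs, abs_of_nonneg (by positivity)]
    exact pow_le_one₀ hc0 hc1
  have h1 := norm_nonneg (x ^ k)
  have h2 := norm_nonneg (a k)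
  gcongr
  nlinarith

lemma aux_feq (p t x u r m : ℝ) (a : ℕ → ℝ) (hp0 : 0 < p) (hp1 : p < 1)
    (hr0 : 0 ≤ r) (hr1 : r ≤ 1)
    (ha : ∀ k, a (k + 1) * ((1 - p ^ (k + 1)) * (1 - t * p ^ (k + 1))) = a k * (u * r ^ k * m))
    (h : Summable (fun k => ‖a k * x ^ k‖)) :
    t * auxF a (p * (p * x)) - (t + 1) * auxF a (p * x) + auxF a x = m * x * u * auxF a (r * x) := by
  have s0 := h.of_norm.hasSum
  have h1 := aux_summable_mul a x p hp0.le hp1.le h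
  have s1 := h1.of_norm.hasSum
  have s2 := (aux_summable_mul a _ p hp0.le hp1.le h1).of_norm.hasSum
  have sr := (aux_summable_mul a x r hr0 hr1 h).of_norm.hasSum
  have A := ((s2.mul_left t).sub (s1.mul_left (t + 1))).add s0
  have B := sr.mul_left (m * x * u)
  have C := (hasSum_nat_add_iff' 1).2 A
  unfold auxF
  have e : (fun k => m * x * u * (a k * (r * x) ^ k)) = fun k : ℕ =>
      t * (a (k + 1) * (p * (p * x)) ^ (k + 1)) - (t + 1) * (a (k + 1) * (p * x) ^ (k + 1))
        + a (k + 1) * x ^ (k + 1) := by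
    funext k
    simp only [mul_pow]
    linear_combination -x ^ (k + 1) * ha k
  rw [e] at B
  have E := C.unique B
  simp at E
  linarith

lemma aux_lim (p x : ℝ) (a : ℕ → ℝ) (hp0 : 0 < p) (hp1 : p < 1)
    (h : Summable (fun k => ‖a k * x ^ k‖)) :
    Tendsto (fun n : ℕ => auxF a (p ^ n * x)) atTop (𝓝 (a 0)) := by
  have e : a 0 = ∑' k, (if k = 0 then a 0 else 0) := by simp
  rw [e]
  refine tendsto_tsum_of_dominated_convergence h (fun k => ?_) (Eventually.of_forall fun n k => ?_)
  · rcases Nat.eq_zero_or_pos k with rfl | hk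
    · simp
    · have h0 : Tendsto (fun n : ℕ => p ^ n * x) atTop (𝓝 0) := by
        simpa using (tendsto_pow_atTop_nhds_zero_of_lt_one hp0.le hp1).mul_const x
      have := (h0.pow k).const_mul (a k)
      simpa [hk.ne'] using this
  · rw [mul_pow, norm_mul, norm_mul, norm_mul]
    have : ‖(p ^ n) ^ k‖ ≤ 1 := by
      rw [Real.norm_eq_abs, abs_of_nonneg (by positivity)]
      exact pow_le_one₀ (by positivity) (pow_le_one₀ hp0.le hp1.le)
    have h1 := norm_nonneg (x ^ k)
    have h2 := norm_nonneg (a k)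
    gcongr
    nlinarith

lemma aux_Iq (q ν w : ℝ) (j : ℕ) (hw : 0 < w) :
    Iq q j ν w = (w / 2) ^ ν * auxF (auxCf q (2 - delta j) ν) (w ^ 2 / 4) := by
  unfold Iq auxF auxCf
  rw [← tsum_mul_left]
  refine tsum_congr fun k => ?_
  have : (w / 2) ^ (ν + 2 * (k : ℝ)) = (w / 2) ^ ν * (w ^ 2 / 4) ^ k := by
    rw [show (2 * (k : ℝ)) = ((2 * k : ℕ) : ℝ) by push_cast; ring, rpow_add (by positivity),
      rpow_natCast, pow_mul]
    congr 2
    ring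
  rw [this]
  ring

def auxV (t p : ℝ) (a b : ℕ → ℝ) (x : ℝ) : ℝ :=
  auxF a x * auxF b (p * x) - t * auxF a (p * x) * auxF b x

lemma aux_V_lim (t p x : ℝ) (a b : ℕ → ℝ) (hp0 : 0 < p) (hp1 : p < 1)
    (ha : Summable (fun k => ‖a k * x ^ k‖)) (hb : Summable (fun k => ‖b k * x ^ k‖)) :
    Tendsto (fun n : ℕ => auxV t p a b (p ^ n * x)) atTop (𝓝 ((1 - t) * a 0 * b 0)) := by
  have A := aux_lim p x a hp0 hp1 ha
  have B := aux_lim p x b hp0 hp1 hb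
  have A1 := (tendsto_add_atTop_iff_nat 1).2 A
  have B1 := (tendsto_add_atTop_iff_nat 1).2 B
  have := (A.mul B1).sub ((A1.const_mul t).mul B)
  have e : (1 - t) * a 0 * b 0 = a 0 * b 0 - t * a 0 * b 0 := by ring
  rw [e]
  refine this.congr fun n => ?_
  unfold auxV
  rw [show p ^ (n + 1) * x = p * (p ^ n * x) by ring]

lemma aux_s1 (V : ℝ → ℝ) (p x c l : ℝ) (hp0 : 0 < p) (hp1 : p < 1)
    (hV : ∀ n : ℕ, V (p * (p ^ n * x)) = (1 - c * (p ^ n * x)) * V (p ^ n * x))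
    (hl : Tendsto (fun n : ℕ => V (p ^ n * x)) atTop (𝓝 l)) :
    l = qPochInf (c * x) p * V x := by
  refine tendsto_nhds_unique hl (((aux_qPoch_tendsto (c * x) p hp0 hp1).mul_const (V x)).congr ?_)
  intro n
  induction n with
  | zero => simp [qPoch]
  | succ n ih =>
    rw [pow_succ', mul_assoc, hV, ← ih]
    unfold qPoch
    rw [Finset.prod_range_succ]
    ring

lemma aux_s2 (V : ℝ → ℝ) (p x c l : ℝ) (hp0 : 0 < p) (hp1 : p < 1)
    (hV : ∀ n : ℕ, (1 - c * (p ^ n * x)) * V (p * (p ^ n * x)) = V (p ^ n * x))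
    (hl : Tendsto (fun n : ℕ => V (p ^ n * x)) atTop (𝓝 l)) :
    V x = qPochInf (c * x) p * l := by
  have := (aux_qPoch_tendsto (c * x) p hp0 hp1).mul hl
  refine tendsto_nhds_unique (tendsto_const_nhds.congr ?_) this
  intro n
  induction n with
  | zero => simp [qPoch]
  | succ n ih =>
    rw [ih, ← hV n, pow_succ', mul_assoc]
    unfold qPoch
    rw [Finset.prod_range_succ]
    ring

/-- the q-Wronskian of `I_ν^{(j)}` and `I_{-ν}^{(j)}`.
Here `e_{q²}(w) = 1/(w;q²)_∞` and `E_{q²}(w) = (-w;q²)_∞`. -/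
theorem stmt3 (q ν : ℝ) (hq0 : 0 < q) (hq1 : q < 1)
    (j : ℕ) (hj : j = 1 ∨ j = 2 ∨ j = 3)
    (z : ℝ) (hz : 0 < z) (hz1 : j = 1 → z < 2 / (1 - q ^ 2)) :
    qWron q (fun w => Iq q j ν w) (fun w => Iq q j (-ν) w) z
      = q ^ (-ν) * (1 - q ^ 2) * qGammaInv q ν * qGammaInv q (1 - ν)
          * (if j = 1 then (qPochInf ((1 - q ^ 2) ^ 2 * z ^ 2 / 4) (q ^ 2))⁻¹
             else if j = 2 then qPochInf ((1 - q ^ 2) ^ 2 * q ^ 2 * z ^ 2 / 4) (q ^ 2)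
             else 1) := by
  have hp1 : q ^ 2 < 1 := by nlinarith
  have hp0 : 0 < q ^ 2 := by positivity
  set s : ℝ := 2 - delta j with hs
  set x : ℝ := z ^ 2 / 4 with hx
  have hx0 : 0 < x := by positivity
  set p : ℝ := q ^ 2 with hp
  set t : ℝ := q ^ (2 * ν) with ht
  have ht0 : 0 < t := rpow_pos_of_pos hq0 _
  have ht' : q ^ (2 * -ν) = t⁻¹ := by rw [ht, ← rpow_neg hq0.le]; congr 1; ring
  set a := auxCf q s ν with ha
  set b := auxCf q s (-ν) with hb
  have hs0 : 0 ≤ s := by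
    rcases hj with rfl | rfl | rfl <;> simp [hs, delta]
  have hr0 : 0 ≤ q ^ (2 * s) := by positivity
  have hr1 : q ^ (2 * s) ≤ 1 := rpow_le_one hq0.le hq1.le (by positivity)
  have key : ∀ μ : ℝ, Summable (fun k => ‖auxCf q s μ k * x ^ k‖) := by
    intro μ
    have hU : ∀ k : ℕ, 0 ≤ q ^ (s * (μ + 1)) * (q ^ (2 * s)) ^ k * (1 - q ^ 2) ^ 2 := by
      intro k; positivity
    rcases eq_or_lt_of_le hs0 with h0 | h0
    · have hj1 : j = 1 := by
        rcases hj with rfl | rfl | rfl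
        · rfl
        · norm_num [hs, delta] at h0
        · norm_num [hs, delta] at h0
      have hz2 := hz1 hj1
      refine aux_summable p (q ^ (2 * μ)) x ((1 - p) ^ 2 * x) _ _ hp0 hp1 hx0
        (auxCf_succ q s μ hq0 hq1) hU ?_ ?_
      · simp [← h0, ← hp]
      · rw [lt_div_iff₀ (by linarith)] at hz2
        have : 0 < z * (1 - p) := mul_pos hz (by linarith)
        rw [hx]
        nlinarith
    · refine aux_summable p (q ^ (2 * μ)) x 0 _ _ hp0 hp1 hx0
        (auxCf_succ q s μ hq0 hq1) hU ?_ one_pos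
      have hlt : q ^ (2 * s) < 1 := rpow_lt_one hq0.le hq1 (by positivity)
      have := (((tendsto_pow_atTop_nhds_zero_of_lt_one hr0 hlt).const_mul
        (q ^ (s * (μ + 1)))).mul_const ((1 - q ^ 2) ^ 2)).mul_const x
      simpa using this
  have hlim := aux_V_lim t p x a b hp0 hp1 (key ν) (key (-ν))
  have hFa : ∀ n : ℕ, _ := fun n => aux_feq p t (p ^ n * x) (q ^ (s * (ν + 1))) (q ^ (2 * s))
    ((1 - p) ^ 2) a hp0 hp1 hr0 hr1 (auxCf_succ q s ν hq0 hq1)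
    (aux_summable_mul _ _ _ (by positivity) (pow_le_one₀ hp0.le hp1.le) (key ν))
  have hFb : ∀ n : ℕ, _ := fun n => aux_feq p (q ^ (2 * -ν)) (p ^ n * x) (q ^ (s * (-ν + 1)))
    (q ^ (2 * s))
    ((1 - p) ^ 2) b hp0 hp1 hr0 hr1 (auxCf_succ q s (-ν) hq0 hq1)
    (aux_summable_mul _ _ _ (by positivity) (pow_le_one₀ hp0.le hp1.le) (key (-ν)))
  have hFb' : ∀ n : ℕ, auxF b (p * (p * (p ^ n * x))) = (1 + t) * auxF b (p * (p ^ n * x))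
      - t * auxF b (p ^ n * x) + (1 - p) ^ 2 * (p ^ n * x) * (t * q ^ (s * (-ν + 1)))
        * auxF b (q ^ (2 * s) * (p ^ n * x)) := by
    intro n
    have := hFb n
    rw [ht'] at this
    have ht1 : t * t⁻¹ = 1 := mul_inv_cancel₀ ht0.ne'
    linear_combination t * this - (auxF b (p * (p * (p ^ n * x))) - auxF b (p * (p ^ n * x))) * ht1
  have hW : qWron q (fun w => Iq q j ν w) (fun w => Iq q j (-ν) w) z
      = q ^ (-ν) * auxV t p a b x := by
    unfold qWron auxV
    simp only []
    rw [aux_Iq q ν z j hz, aux_Iq q (-ν) z j hz, aux_Iq q ν (q * z) j (by positivity),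
      aux_Iq q (-ν) (q * z) j (by positivity), ← hs, ← ha, ← hb,
      show (q * z) ^ 2 / 4 = p * x by rw [hp, hx]; ring, ← hx,
      show q * z / 2 = q * (z / 2) by ring, mul_rpow hq0.le (by positivity),
      mul_rpow hq0.le (by positivity)]
    have e1 : (z / 2) ^ ν * (z / 2) ^ (-ν) = 1 := by
      rw [← rpow_add (by positivity)]; simp
    have e2 : q ^ ν = q ^ (-ν) * t := by
      rw [ht, ← rpow_add hq0]; congr 1; ring
    rw [e2]
    linear_combination (q ^ (-ν) * (auxF a x * auxF b (p * x)
      - t * auxF a (p * x) * auxF b x)) * e1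
  have hC : q ^ (-ν) * (1 - p) * qGammaInv q ν * qGammaInv q (1 - ν)
      = q ^ (-ν) * ((1 - t) * a 0 * b 0) := by
    rw [ha, hb, auxCf_zero, auxCf_zero, show -ν + 1 = 1 - ν by ring]
    have := aux_gamma q ν hq0 hq1
    linear_combination q ^ (-ν) * qGammaInv q (1 - ν) * this
  rw [hW, hC, mul_assoc]
  congr 1
  rcases hj with rfl | rfl | rfl
  · have hs' : s = 0 := by norm_num [hs, delta]
    simp only [hs', mul_zero, zero_mul, rpow_zero, one_mul, mul_one] at hFa hFb'
    have := aux_s1 (auxV t p a b) p x ((1 - p) ^ 2) _ hp0 hp1 (fun n => by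
      unfold auxV
      rw [hFb' n]
      linear_combination (-auxF b (p * (p ^ n * x))) * hFa n) hlim
    have hz2 := hz1 rfl
    rw [lt_div_iff₀ (by linarith)] at hz2
    have h0 : 0 < z * (1 - p) := mul_pos hz (by linarith)
    have hne := aux_qPochInf_ne ((1 - p) ^ 2 * x) p (by positivity) (by rw [hx]; nlinarith) hp0 hp1
    rw [if_pos rfl, this, show (1 - p) ^ 2 * z ^ 2 / 4 = (1 - p) ^ 2 * x by rw [hx]; ring]
    field_simp
  · have hs' : s = 2 := by norm_num [hs, delta]
    have e1 : q ^ (s * (ν + 1)) = p * t := by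
      rw [hs', hp, ht, ← rpow_natCast, ← rpow_add hq0]; congr 1; push_cast; ring
    have e2 : t * q ^ (s * (-ν + 1)) = p := by
      rw [hs', hp, ht, ← rpow_natCast, ← rpow_add hq0]; congr 1; push_cast; ring
    have e3 : ∀ y, q ^ (2 * s) * y = p * (p * y) := by
      intro y
      rw [hs', hp, show (2 * 2 : ℝ) = ((4 : ℕ) : ℝ) by norm_num, rpow_natCast]; ring
    simp only [e1, e2, e3] at hFa hFb'
    have := aux_s2 (auxV t p a b) p x ((1 - p) ^ 2 * p) _ hp0 hp1 (fun n => by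
      unfold auxV
      linear_combination (auxF a (p * (p ^ n * x))) * hFb' n
        - auxF b (p * (p ^ n * x)) * hFa n) hlim
    rw [if_neg (by norm_num), if_pos rfl, this,
      show (1 - p) ^ 2 * p * z ^ 2 / 4 = (1 - p) ^ 2 * p * x by rw [hx]; ring]
    ring
  · have hs' : s = 1 := by norm_num [hs, delta]
    have e1 : t * q ^ (s * (-ν + 1)) = q ^ (s * (ν + 1)) := by
      rw [hs', ht, ← rpow_add hq0]; congr 1; ring
    have e3 : q ^ (2 * s) = p := by
      rw [hs', hp, ← rpow_natCast]; norm_num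
    simp only [e1, e3] at hFa hFb'
    have := aux_s1 (auxV t p a b) p x 0 _ hp0 hp1 (fun n => by
      unfold auxV
      rw [hFb' n]
      linear_combination (-auxF b (p * (p ^ n * x))) * hFa n) hlim
    rw [this]
    simp [qPochInf]
end
end

section
/- For every real ν > 3/2, the two-sided series below converges absolutely and the Jackson q-integral evaluation 2(1-q) Σ_{m=-∞}^{∞} q^m · (-q^{ν+3/2+2m};q²)_∞ / (-q^{-ν+1/2+2m};q²)_∞ = 2 q^{ν/2-1/4} · Q_{ν/2+1/4} · (q^{2ν+1};q²)_∞ (q;q²)_∞ / ((q^{2ν};q²)_∞ (q²;q²)_∞) holds (the left-hand side equals ∫_{-∞}^{∞} (-q^{ν+3/2}s²;q²)_∞/(-q^{-ν+1/2}s²;q²)_∞ d_q s). -/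
open Real Filter

noncomputable section

/-- `Q_μ = (1-q) Σ_{m ∈ ℤ} 1/(q^{m+μ-1/2} + q^{-m-μ+1/2})`. -/
def Qcoef (q μ : ℝ) : ℝ :=
  (1 - q) * ∑' m : ℤ, 1 / (q ^ ((m : ℝ) + μ - 1/2) + q ^ (-(m : ℝ) - μ + 1/2))


section Helpers

open Topology

lemma summ_aux (y p : ℝ) (hp0 : 0 ≤ p) (hp1 : p < 1) : Summable (fun j : ℕ => -(y * p ^ j)) :=
  ((summable_geometric_of_lt_one hp0 hp1).mul_left y).neg

lemma mult_aux (y p : ℝ) (hp0 : 0 ≤ p) (hp1 : p < 1) :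
    Multipliable (fun j : ℕ => 1 - y * p ^ j) := by
  simpa [sub_eq_add_neg] using Real.multipliable_one_add_of_summable (summ_aux y p hp0 hp1)

lemma tend_aux (y p : ℝ) (hp0 : 0 ≤ p) (hp1 : p < 1) :
    Tendsto (fun n : ℕ => qPoch y p n) atTop (𝓝 (qPochInf y p)) :=
  (mult_aux y p hp0 hp1).tendsto_prod_tprod_nat

lemma qPochInf_succ (y p : ℝ) (hp0 : 0 ≤ p) (hp1 : p < 1) :
    qPochInf y p = (1 - y) * qPochInf (y * p) p := by
  have e : (fun j : ℕ => 1 - y * p * p ^ j) = fun j : ℕ => 1 - y * p ^ (j + 1) := by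
    funext j; ring
  have h : Multipliable (fun j : ℕ => 1 - y * p ^ (j + 1)) := by
    rw [← e]; exact mult_aux (y * p) p hp0 hp1
  have h2 := tprod_eq_zero_mul' (f := fun j : ℕ => 1 - y * p ^ j) h
  have h3 : qPochInf (y * p) p = ∏' j : ℕ, (1 - y * p ^ (j + 1)) :=
    congrArg (fun f : ℕ → ℝ => ∏' j, f j) e
  rw [h3]
  simpa [qPochInf] using h2

lemma qPochInf_shift (y p : ℝ) (hp0 : 0 ≤ p) (hp1 : p < 1) (n : ℕ) :
    qPochInf y p = qPoch y p n * qPochInf (y * p ^ n) p := by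
  induction n with
  | zero => simp [qPoch]
  | succ k ih =>
    rw [ih, qPochInf_succ (y * p ^ k) p hp0 hp1]
    simp only [qPoch, Finset.prod_range_succ]
    rw [pow_succ, ← mul_assoc y]
    ring

lemma qPochInf_ne (y p : ℝ) (hp0 : 0 ≤ p) (hp1 : p < 1) (hy : y < 1) :
    qPochInf y p ≠ 0 := by
  have := tprod_one_add_ne_zero_of_summable (f := fun j : ℕ => -(y * p ^ j)) (fun j => by
    have h1 : p ^ j ≤ 1 := pow_le_one₀ hp0 hp1.le
    have h0 : 0 ≤ p ^ j := pow_nonneg hp0 j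
    have : y * p ^ j < 1 := by
      rcases le_or_gt y 0 with h | h
      · nlinarith
      · nlinarith
    intro h
    linarith) (summ_aux y p hp0 hp1).norm
  simpa [qPochInf, sub_eq_add_neg] using this

lemma qPochInf_mono (y z p : ℝ) (hp0 : 0 ≤ p) (hp1 : p < 1) (hyz : z ≤ y) (hy : y ≤ 0) :
    qPochInf y p ≤ qPochInf z p := by
  refine le_of_tendsto_of_tendsto' (tend_aux y p hp0 hp1) (tend_aux z p hp0 hp1) fun n => ?_
  refine Finset.prod_le_prod (fun j _ => ?_) (fun j _ => ?_)
  · have h0 : 0 ≤ p ^ j := pow_nonneg hp0 j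
    nlinarith
  · have h0 : 0 ≤ p ^ j := pow_nonneg hp0 j
    nlinarith

lemma qPochInf_zero (p : ℝ) : qPochInf 0 p = 1 := by simp [qPochInf]

lemma qPochInf_ge_one (y p : ℝ) (hp0 : 0 ≤ p) (hp1 : p < 1) (hy : y ≤ 0) :
    1 ≤ qPochInf y p := by
  rw [← qPochInf_zero p]
  exact qPochInf_mono 0 y p hp0 hp1 hy le_rfl

lemma qPochInf_tend (y p : ℝ) (hp0 : 0 ≤ p) (hp1 : p < 1) (hy : y < 1) :
    Tendsto (fun n : ℕ => qPochInf (y * p ^ n) p) atTop (𝓝 1) := by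
  have hne := qPochInf_ne y p hp0 hp1 hy
  have h := (tendsto_const_nhds (x := qPochInf y p)).div (tend_aux y p hp0 hp1) hne
  rw [div_self hne] at h
  refine h.congr fun n => ?_
  have hs := qPochInf_shift y p hp0 hp1 n
  have : qPoch y p n ≠ 0 := by
    intro h0
    rw [h0, zero_mul] at hs
    exact hne hs
  simp only [Pi.div_apply]
  rw [div_eq_iff this, hs]
  ring

/-- The general term. -/
def gterm (q x β : ℝ) (m : ℤ) : ℝ :=
  q ^ m * qPochInf (-(x * β * (q ^ 2) ^ m)) (q ^ 2) / qPochInf (-(x * (q ^ 2) ^ m)) (q ^ 2)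

variable {q x : ℝ}

lemma gterm_pos (hq0 : 0 < q) (hq1 : q < 1) (hx : 0 < x) {β : ℝ} (hβ : 0 ≤ β) (m : ℤ) :
    0 < gterm q x β m := by
  have hp1 : q ^ 2 < 1 := by nlinarith
  have h1 := qPochInf_ge_one (-(x * β * (q ^ 2) ^ m)) (q ^ 2) (by positivity) hp1
    (by have : 0 ≤ x * β * (q ^ 2) ^ m := by positivity
        linarith)
  have h2 := qPochInf_ge_one (-(x * (q ^ 2) ^ m)) (q ^ 2) (by positivity) hp1
    (by have : 0 ≤ x * (q ^ 2) ^ m := by positivity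
        linarith)
  unfold gterm
  have : 0 < q ^ m := by positivity
  positivity

lemma gterm_mono (hq0 : 0 < q) (hq1 : q < 1) (hx : 0 < x) {β γ : ℝ} (hβ : 0 ≤ β) (h : β ≤ γ)
    (m : ℤ) : gterm q x β m ≤ gterm q x γ m := by
  have hp1 : q ^ 2 < 1 := by nlinarith
  have h2 := qPochInf_ge_one (-(x * (q ^ 2) ^ m)) (q ^ 2) (by positivity) hp1
    (by have : 0 ≤ x * (q ^ 2) ^ m := by positivity
        linarith)
  have h3 := qPochInf_mono (-(x * β * (q ^ 2) ^ m)) (-(x * γ * (q ^ 2) ^ m)) (q ^ 2)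
    (by positivity) hp1 (by gcongr) (by
      have : 0 ≤ x * β * (q ^ 2) ^ m := by positivity
      linarith)
  unfold gterm
  gcongr

lemma gterm_one (hq0 : 0 < q) (hq1 : q < 1) (hx : 0 < x) (m : ℤ) :
    gterm q x 1 m = q ^ m := by
  have hp1 : q ^ 2 < 1 := by nlinarith
  have h2 := qPochInf_ge_one (-(x * (q ^ 2) ^ m)) (q ^ 2) (by positivity) hp1
    (by have : 0 ≤ x * (q ^ 2) ^ m := by positivity
        linarith)
  unfold gterm
  rw [mul_one]
  field_simp

/-- shift in `m` -/
lemma gterm_succ (hq0 : 0 < q) (hq1 : q < 1) (hx : 0 < x) {β : ℝ} (hβ : 0 ≤ β) (m : ℤ) :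
    gterm q x β m * q * (1 + x * (q ^ 2) ^ m) =
      gterm q x β (m + 1) * (1 + x * β * (q ^ 2) ^ m) := by
  have hp1 : q ^ 2 < 1 := by nlinarith
  have h2 := qPochInf_ge_one (-(x * (q ^ 2) ^ (m+1))) (q ^ 2) (by positivity) hp1
    (by have : 0 ≤ x * (q ^ 2) ^ (m+1) := by positivity
        linarith)
  have e1 := qPochInf_succ (-(x * (q ^ 2) ^ m)) (q ^ 2) (by positivity) hp1
  have e2 := qPochInf_succ (-(x * β * (q ^ 2) ^ m)) (q ^ 2) (by positivity) hp1
  have hz : (q ^ 2) ^ (m + 1) = (q ^ 2) ^ m * q ^ 2 := zpow_add_one₀ (by positivity) m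
  have hz' : q ^ (m + 1) = q ^ m * q := zpow_add_one₀ (by positivity) m
  have a1 : -(x * (q ^ 2) ^ m) * q ^ 2 = -(x * (q ^ 2) ^ (m + 1)) := by rw [hz]; ring
  have a2 : -(x * β * (q ^ 2) ^ m) * q ^ 2 = -(x * β * (q ^ 2) ^ (m + 1)) := by rw [hz]; ring
  rw [a1] at e1
  rw [a2] at e2
  unfold gterm
  rw [e1, e2, hz']
  have : 0 < x * (q ^ 2) ^ m := by positivity
  have h3 : 1 - -(x * (q ^ 2) ^ m) ≠ 0 := by linarith
  have h4 : qPochInf (-(x * (q ^ 2) ^ (m+1))) (q ^ 2) ≠ 0 := by linarith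
  generalize qPochInf (-(x * (q ^ 2) ^ (m+1))) (q ^ 2) = A at *
  generalize qPochInf (-(x * β * (q ^ 2) ^ (m+1))) (q ^ 2) = B at *
  generalize (q ^ 2) ^ m = u at *
  field_simp
  ring

/-- shift in `β` -/
lemma gterm_beta (hq0 : 0 < q) (hq1 : q < 1) {β : ℝ} (m : ℤ) :
    gterm q x β m = (1 + x * β * (q ^ 2) ^ m) * gterm q x (β * q ^ 2) m := by
  have hp1 : q ^ 2 < 1 := by nlinarith
  have e2 := qPochInf_succ (-(x * β * (q ^ 2) ^ m)) (q ^ 2) (by positivity) hp1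
  have a2 : -(x * β * (q ^ 2) ^ m) * q ^ 2 = -(x * (β * q ^ 2) * (q ^ 2) ^ m) := by ring
  rw [a2] at e2
  unfold gterm
  rw [e2]
  ring

lemma gterm_summable (hq0 : 0 < q) (hq1 : q < 1) (hx : 0 < x) {β : ℝ} (hβ : 0 ≤ β)
    (hβq : β < q) : Summable (gterm q x β) := by
  refine Summable.of_nat_of_neg ?_ ?_
  · refine Summable.of_nonneg_of_le (fun n => (gterm_pos hq0 hq1 hx hβ _).le) (fun n => ?_)
      (summable_geometric_of_lt_one hq0.le hq1)
    have := gterm_mono hq0 hq1 hx hβ (hβq.le.trans hq1.le) (n : ℤ)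
    rwa [gterm_one hq0 hq1 hx, zpow_natCast] at this
  · refine summable_of_ratio_test_tendsto_lt_one (l := β / q) ((div_lt_one hq0).2 hβq)
      (Eventually.of_forall fun n => (gterm_pos hq0 hq1 hx hβ _).ne') ?_
    have hT : Tendsto (fun n : ℕ => (q ^ 2) ^ (n + 1)) atTop (𝓝 0) :=
      (tendsto_pow_atTop_nhds_zero_of_lt_one (by positivity) (by nlinarith)).comp
        (tendsto_add_atTop_nat 1)
    have hL : Tendsto (fun n : ℕ => ((q ^ 2) ^ (n + 1) + x * β) / (q * ((q ^ 2) ^ (n + 1) + x)))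
        atTop (𝓝 ((0 + x * β) / (q * (0 + x)))) := by
      refine Tendsto.div (hT.add_const _) ((hT.add_const _).const_mul _) ?_
      positivity
    have e : (0 + x * β) / (q * (0 + x)) = β / q := by field_simp; ring
    rw [e] at hL
    refine hL.congr fun n => ?_
    have p1 := gterm_pos hq0 hq1 hx hβ (-((n + 1 : ℕ) : ℤ))
    have p2 := gterm_pos hq0 hq1 hx hβ (-(n : ℤ))
    rw [Real.norm_of_nonneg p1.le, Real.norm_of_nonneg p2.le]
    have hs := gterm_succ hq0 hq1 hx hβ (-((n + 1 : ℕ) : ℤ))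
    have i1 : -((n + 1 : ℕ) : ℤ) + 1 = -(n : ℤ) := by push_cast; ring
    rw [i1, zpow_neg, zpow_natCast] at hs
    have hu : 0 < (q ^ 2) ^ (n + 1) := by positivity
    generalize (q ^ 2) ^ (n + 1) = u at *
    rw [div_eq_div_iff (by positivity) p2.ne']
    field_simp at hs
    linarith

/-- The sum. -/
def gsum (q x β : ℝ) : ℝ := ∑' m : ℤ, gterm q x β m

lemma gsum_rec (hq0 : 0 < q) (hq1 : q < 1) (hx : 0 < x) {β : ℝ} (hβ : 0 ≤ β)
    (hβq : β < q) : (1 - β / q) * gsum q x β = (1 - β) * gsum q x (β * q ^ 2) := by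
  have hβ' : β * q ^ 2 ≤ β := by nlinarith [mul_nonneg hβ (by nlinarith : (0:ℝ) ≤ 1 - q ^ 2)]
  have s1 := gterm_summable hq0 hq1 hx hβ hβq
  have s2 := gterm_summable hq0 hq1 hx (β := β * q ^ 2) (by positivity) (hβ'.trans_lt hβq)
  have s3 : Summable (fun m : ℤ => gterm q x β (m + 1)) :=
    (Equiv.addRight (1 : ℤ)).summable_iff.2 s1
  have t3 : ∑' m : ℤ, gterm q x β (m + 1) = gsum q x β :=
    (Equiv.addRight (1 : ℤ)).tsum_eq (gterm q x β)
  have key : ∀ m : ℤ, gterm q x β m - β / q * gterm q x β (m + 1) =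
      (1 - β) * gterm q x (β * q ^ 2) m := by
    intro m
    have h1 := gterm_succ hq0 hq1 hx hβ m
    have h2 := gterm_beta (x := x) hq0 hq1 (β := β) m
    have hu : 0 < (q ^ 2) ^ m := by positivity
    have hpos : 1 + x * β * (q ^ 2) ^ m ≠ 0 := by positivity
    have h3 : gterm q x β (m + 1) = gterm q x (β * q ^ 2) m * q * (1 + x * (q ^ 2) ^ m) := by
      apply mul_right_cancel₀ hpos
      rw [← h1, h2]; ring
    rw [h3, h2]
    field_simp
    ring
  have := s1.tsum_sub (s3.mul_left (β / q))
  rw [tsum_congr key, tsum_mul_left, tsum_mul_left, t3] at this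
  unfold gsum at *
  linarith

lemma gsum_iter (hq0 : 0 < q) (hq1 : q < 1) (hx : 0 < x) {β : ℝ} (hβ : 0 ≤ β)
    (hβq : β < q) (n : ℕ) : qPoch (β / q) (q ^ 2) n * gsum q x β =
      qPoch β (q ^ 2) n * gsum q x (β * (q ^ 2) ^ n) := by
  induction n with
  | zero => simp [qPoch]
  | succ k ih =>
    have hk1 : (q ^ 2) ^ k ≤ 1 := pow_le_one₀ (by positivity) (by nlinarith)
    have hk : β * (q ^ 2) ^ k ≤ β := mul_le_of_le_one_right hβ hk1
    have := gsum_rec hq0 hq1 hx (β := β * (q ^ 2) ^ k) (by positivity) (hk.trans_lt hβq)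
    simp only [qPoch, Finset.prod_range_succ] at *
    rw [pow_succ (q ^ 2) k, ← mul_assoc β]
    calc _ = (1 - β / q * (q ^ 2) ^ k) *
          ((∏ j ∈ Finset.range k, (1 - β / q * (q ^ 2) ^ j)) * gsum q x β) := by ring
      _ = (∏ j ∈ Finset.range k, (1 - β * (q ^ 2) ^ j)) *
          ((1 - β * (q ^ 2) ^ k / q) * gsum q x (β * (q ^ 2) ^ k)) := by rw [ih]; ring
      _ = _ := by rw [this]; ring

lemma gsum_tend (hq0 : 0 < q) (hq1 : q < 1) (hx : 0 < x) {β : ℝ} (hβ : 0 ≤ β)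
    (hβq : β < q) : Tendsto (fun n : ℕ => gsum q x (β * (q ^ 2) ^ n)) atTop
      (𝓝 (gsum q x 0)) := by
  have hp1 : q ^ 2 < 1 := by nlinarith
  refine tendsto_tsum_of_dominated_convergence (bound := gterm q x β)
    (gterm_summable hq0 hq1 hx hβ hβq) (fun m => ?_) (Eventually.of_forall fun n m => ?_)
  · have h := qPochInf_tend (-(x * β * (q ^ 2) ^ m)) (q ^ 2) (by positivity) hp1 (by
      have : 0 ≤ x * β * (q ^ 2) ^ m := by positivity
      linarith)
    have := (h.const_mul (q ^ m)).div_const (qPochInf (-(x * (q ^ 2) ^ m)) (q ^ 2))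
    unfold gterm
    rw [mul_zero, zero_mul, neg_zero, qPochInf_zero]
    refine this.congr fun n => ?_
    congr 3
    ring
  · have hk1 : (q ^ 2) ^ n ≤ 1 := pow_le_one₀ (by positivity) (by nlinarith)
    rw [Real.norm_of_nonneg (gterm_pos hq0 hq1 hx (by positivity) _).le]
    exact gterm_mono hq0 hq1 hx (by positivity) (mul_le_of_le_one_right hβ hk1) m

lemma gsum_eq (hq0 : 0 < q) (hq1 : q < 1) (hx : 0 < x) {β : ℝ} (hβ : 0 ≤ β)
    (hβq : β < q) : qPochInf (β / q) (q ^ 2) * gsum q x β =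
      qPochInf β (q ^ 2) * gsum q x 0 := by
  have hp1 : q ^ 2 < 1 := by nlinarith
  have h1 := (tend_aux (β / q) (q ^ 2) (by positivity) hp1).mul_const (gsum q x β)
  have h2 := (tend_aux β (q ^ 2) (by positivity) hp1).mul (gsum_tend hq0 hq1 hx hβ hβq)
  exact tendsto_nhds_unique h1 (h2.congr fun n => (gsum_iter hq0 hq1 hx hβ hβq n).symm)

lemma gterm_q2 (hq0 : 0 < q) (hq1 : q < 1) (hx : 0 < x) (m : ℤ) :
    gterm q x (q ^ 2) m = q ^ m / (1 + x * (q ^ 2) ^ m) := by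
  have h := gterm_beta (x := x) hq0 hq1 (β := 1) m
  rw [gterm_one hq0 hq1 hx, mul_one, one_mul] at h
  have : 0 < x * (q ^ 2) ^ m := by positivity
  rw [eq_div_iff (by positivity), h]
  ring

lemma Qcoef_eq (hq0 : 0 < q) (hq1 : q < 1) (ν : ℝ) :
    q ^ (ν / 2 - 1/4) * Qcoef q (ν / 2 + 1/4) =
      (1 - q) * gsum q (q ^ (-ν + 1/2)) (q ^ 2) := by
  unfold Qcoef gsum
  rw [← (Equiv.neg ℤ).tsum_eq, mul_left_comm, ← tsum_mul_left]
  congr 1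
  refine tsum_congr fun m => ?_
  rw [gterm_q2 hq0 hq1 (by positivity)]
  simp only [Equiv.neg_apply]
  rw [← Real.rpow_intCast q m, ← zpow_natCast, ← zpow_mul, ← Real.rpow_intCast q (_ * m),
    ← Real.rpow_add hq0, mul_one_div, div_eq_div_iff (by positivity) (by positivity),
    mul_add, mul_add, ← Real.rpow_add hq0, ← Real.rpow_add hq0, ← Real.rpow_add hq0, mul_one]
  push_cast
  congr 1 <;> congr 1 <;> ring

end Helpers

/-- evaluation of the Jackson q-integral
`∫_{-∞}^{∞} (-q^{ν+3/2}s²;q²)_∞/(-q^{-ν+1/2}s²;q²)_∞ d_q s`, written out as the two-sided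
series `2(1-q) Σ_{m∈ℤ} q^m (-q^{ν+3/2+2m};q²)_∞/(-q^{-ν+1/2+2m};q²)_∞`. -/
theorem stmt18 (q ν : ℝ) (hq0 : 0 < q) (hq1 : q < 1) (hν : 3/2 < ν) :
    Summable (fun m : ℤ =>
      q ^ (m : ℝ) * qPochInf (-q ^ (ν + 3/2 + 2 * (m : ℝ))) (q ^ 2)
        / qPochInf (-q ^ (-ν + 1/2 + 2 * (m : ℝ))) (q ^ 2))
  ∧ 2 * (1 - q) * ∑' m : ℤ,
        q ^ (m : ℝ) * qPochInf (-q ^ (ν + 3/2 + 2 * (m : ℝ))) (q ^ 2)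
          / qPochInf (-q ^ (-ν + 1/2 + 2 * (m : ℝ))) (q ^ 2)
      = 2 * q ^ (ν / 2 - 1/4) * Qcoef q (ν / 2 + 1/4)
          * qPochInf (q ^ (2 * ν + 1)) (q ^ 2) * qPochInf q (q ^ 2)
          / (qPochInf (q ^ (2 * ν)) (q ^ 2) * qPochInf (q ^ 2) (q ^ 2)) := by
  have hp1 : q ^ 2 < 1 := by nlinarith
  have hx : 0 < q ^ (-ν + 1/2) := by positivity
  have hβ0 : 0 ≤ q ^ (2 * ν + 1) := by positivity
  have hβq : q ^ (2 * ν + 1) < q := by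
    have := Real.rpow_lt_rpow_of_exponent_gt hq0 hq1 (show (1:ℝ) < 2 * ν + 1 by linarith)
    rwa [Real.rpow_one] at this
  have hfun : (fun m : ℤ =>
      q ^ (m : ℝ) * qPochInf (-q ^ (ν + 3/2 + 2 * (m : ℝ))) (q ^ 2)
        / qPochInf (-q ^ (-ν + 1/2 + 2 * (m : ℝ))) (q ^ 2)) =
      gterm q (q ^ (-ν + 1/2)) (q ^ (2 * ν + 1)) := by
    funext m
    have hz : (q ^ 2) ^ m = q ^ (2 * (m : ℝ)) := by
      rw [← zpow_natCast, ← zpow_mul, ← Real.rpow_intCast]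
      push_cast
      rfl
    unfold gterm
    rw [hz, ← Real.rpow_add hq0, ← Real.rpow_add hq0, ← Real.rpow_add hq0, Real.rpow_intCast]
    congr 4
    congr 1
    congr 1
    ring
  rw [hfun]
  refine ⟨gterm_summable hq0 hq1 hx hβ0 hβq, ?_⟩
  have h1 := gsum_eq hq0 hq1 hx hβ0 hβq
  have h2 := gsum_eq hq0 hq1 hx (β := q ^ 2) (by positivity) (by nlinarith)
  have d1 : q ^ (2 * ν + 1) / q = q ^ (2 * ν) := by
    rw [Real.rpow_add hq0, Real.rpow_one]
    field_simp
  have d2 : q ^ 2 / q = q := by field_simp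
  rw [d1] at h1
  rw [d2] at h2
  have n1 : qPochInf (q ^ (2 * ν)) (q ^ 2) ≠ 0 := qPochInf_ne _ _ (by positivity) hp1
    (Real.rpow_lt_one hq0.le hq1 (by linarith))
  have n2 : qPochInf (q ^ 2) (q ^ 2) ≠ 0 := qPochInf_ne _ _ (by positivity) hp1 hp1
  rw [mul_assoc 2 (q ^ (ν / 2 - 1/4)), Qcoef_eq hq0 hq1 ν, eq_div_iff (mul_ne_zero n1 n2)]
  change 2 * (1 - q) * gsum q (q ^ (-ν + 1/2)) (q ^ (2 * ν + 1)) * _ = _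
  linear_combination 2 * (1 - q) * qPochInf (q ^ 2) (q ^ 2) * h1 -
    2 * (1 - q) * qPochInf (q ^ (2 * ν + 1)) (q ^ 2) * h2

end
end
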